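/- Let λ > 0, and for n ≥ 2 let b_n be the unique real number with F_λ(b_n) = 1 - 1/n, and set a_n = 1/b_n. Define κ(x) = 2^{-1}(x² + 2x) e^{-x} and ω(x) = -8^{-1}(x⁴ + 4x³ + 8x² + 16x) e^{-x}. Then for every real x, b_n² · ( b_n² · ((F_λ(a_n x + b_n))^n - Λ(x)) - κ(x) Λ(x) ) → (ω(x) + κ(x)²/2) Λ(x) as n → ∞. -/

import Mathlib

open Real MeasureTheory Filter Topology

/-- Standard normal density. -/
noncomputable def stdPhi (x : ℝ) : ℝ := (Real.sqrt (2 * Real.pi))⁻¹ * Real.exp (-(x ^ 2) / 2)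

/-- Standard normal cdf. -/
noncomputable def stdCdf (x : ℝ) : ℝ := ∫ t in Set.Iic x, stdPhi t

/-- Skew normal density with shape parameter l. -/
noncomputable def snPdf (l x : ℝ) : ℝ := 2 * stdPhi x * stdCdf (l * x)

/-- Skew normal cdf with shape parameter l. -/
noncomputable def snCdf (l x : ℝ) : ℝ := ∫ t in Set.Iic x, snPdf l t

/-- Gumbel extreme value distribution function. -/
noncomputable def gumbel (x : ℝ) : ℝ := Real.exp (-Real.exp (-x))

/-- $\kappa(x)$ for $\lambda>0$. -/
noncomputable def kappaPos (x : ℝ) : ℝ := 2⁻¹ * (x ^ 2 + 2 * x) * Real.exp (-x)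

/-- $\omega(x)$ for $\lambda>0$. -/
noncomputable def omegaPos (x : ℝ) : ℝ :=
  -(8⁻¹ * (x ^ 4 + 4 * x ^ 3 + 8 * x ^ 2 + 16 * x) * Real.exp (-x))


lemma stdPhi_pos (x : ℝ) : 0 < stdPhi x := by
  unfold stdPhi; positivity

lemma stdPhi_cont : Continuous stdPhi := by
  unfold stdPhi; fun_prop

lemma stdPhi_even (x : ℝ) : stdPhi (-x) = stdPhi x := by
  simp [stdPhi]

lemma stdPhi_integrable : Integrable stdPhi := by
  unfold stdPhi
  have := (integrable_exp_neg_mul_sq (b := 1/2) (by norm_num)).const_mul (Real.sqrt (2 * Real.pi))⁻¹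
  refine this.congr (ae_of_all _ fun x => ?_)
  simp only
  congr 2; ring

lemma stdPhi_integral : ∫ x, stdPhi x = 1 := by
  unfold stdPhi
  rw [integral_const_mul]
  have h := integral_gaussian (1/2)
  have e : (fun x : ℝ => Real.exp (-(x^2)/2)) = fun x => Real.exp (-(1/2) * x^2) := by
    funext x; congr 1; ring
  rw [e, h]
  have : π / (1/2) = 2 * π := by ring
  rw [this]
  exact inv_mul_cancel₀ (by positivity)

lemma stdPhi_hasDeriv (x : ℝ) : HasDerivAt stdPhi (-x * stdPhi x) x := by
  unfold stdPhi
  have h : HasDerivAt (fun x : ℝ => -(x^2)/2) (-x) x := by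
    have := ((hasDerivAt_pow 2 x).neg).div_const 2
    convert! this using 1
    simp; ring
  convert! (h.exp).const_mul (Real.sqrt (2 * Real.pi))⁻¹ using 1
  ring

lemma hasDeriv_Iic {f : ℝ → ℝ} (hf : Continuous f) (hi : Integrable f) (x : ℝ) :
    HasDerivAt (fun y => ∫ t in Set.Iic y, f t) (f x) x := by
  have e : (fun y => ∫ t in Set.Iic y, f t)
      = fun y => (∫ t in Set.Iic x, f t) + ∫ t in x..y, f t := by
    funext y
    have := intervalIntegral.integral_Iic_sub_Iic (f := f) (μ := volume) (a := x) (b := y)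
      hi.integrableOn hi.integrableOn
    linarith
  rw [e]
  have := (intervalIntegral.integral_hasDerivAt_right (hf.intervalIntegrable x x)
    (hf.stronglyMeasurableAtFilter _ _) hf.continuousAt)
  simpa using this.const_add (∫ t in Set.Iic x, f t)

lemma tendsto_Iic {f : ℝ → ℝ} (hi : Integrable f) :
    Tendsto (fun y => ∫ t in Set.Iic y, f t) atTop (𝓝 (∫ t, f t)) := by
  have := tendsto_setIntegral_of_monotone (μ := volume) (f := f) (s := fun y : ℝ => Set.Iic y)
    (fun i => measurableSet_Iic) (fun a b h => Set.Iic_subset_Iic.2 h)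
    hi.integrableOn
  rw [Set.iUnion_Iic] at this
  simpa using this

lemma stdCdf_hasDeriv (x : ℝ) : HasDerivAt stdCdf (stdPhi x) x :=
  hasDeriv_Iic stdPhi_cont stdPhi_integrable x

lemma stdCdf_cont : Continuous stdCdf :=
  continuous_iff_continuousAt.2 fun x => (stdCdf_hasDeriv x).continuousAt

lemma stdCdf_tendsto : Tendsto stdCdf atTop (𝓝 1) := by
  have := tendsto_Iic stdPhi_integrable
  rwa [stdPhi_integral] at this

lemma stdCdf_pos (x : ℝ) : 0 < stdCdf x := by
  unfold stdCdf
  rw [setIntegral_pos_iff_support_of_nonneg_ae (ae_of_all _ fun x => (stdPhi_pos x).le) stdPhi_integrable.integrableOn]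
  have : Function.support stdPhi = Set.univ := by
    ext y; simp [(stdPhi_pos y).ne']
  simp [this]

lemma stdCdf_symm (x : ℝ) : stdCdf x + stdCdf (-x) = 1 := by
  have h1 : stdCdf (-x) = ∫ t in Set.Ioi x, stdPhi t := by
    unfold stdCdf
    rw [← integral_comp_neg_Ioi]
    simp [stdPhi_even]
  rw [h1, ← stdPhi_integral]
  unfold stdCdf
  rw [← Set.compl_Iic]
  exact integral_add_compl measurableSet_Iic stdPhi_integrable

lemma snPdf_cont (l : ℝ) : Continuous (snPdf l) := by
  unfold snPdf
  exact (continuous_const.mul stdPhi_cont).mul (stdCdf_cont.comp (by fun_prop))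

lemma snPdf_pos (l x : ℝ) : 0 < snPdf l x := by
  unfold snPdf
  have := stdPhi_pos x
  have := stdCdf_pos (l * x)
  positivity

lemma stdCdf_lt_one (x : ℝ) : stdCdf x < 1 := by
  have := stdCdf_symm x
  have := stdCdf_pos (-x)
  linarith

lemma snPdf_integrable (l : ℝ) : Integrable (snPdf l) := by
  refine (stdPhi_integrable.const_mul 2).mono' (snPdf_cont l).aestronglyMeasurable
    (ae_of_all _ fun x => ?_)
  rw [Real.norm_of_nonneg (snPdf_pos l x).le]
  unfold snPdf
  have := stdPhi_pos x
  have := stdCdf_lt_one (l * x)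
  nlinarith

lemma snPdf_integral (l : ℝ) : ∫ x, snPdf l x = 1 := by
  have h1 : ∫ x, snPdf l (-x) = ∫ x, snPdf l x := integral_neg_eq_self _ _
  have h2 : ∫ x, (snPdf l x + snPdf l (-x)) = (∫ x, snPdf l x) + ∫ x, snPdf l (-x) :=
    integral_add (snPdf_integrable l) (snPdf_integrable l).comp_neg
  have h3 : (fun x => snPdf l x + snPdf l (-x)) = fun x => 2 * stdPhi x := by
    funext x
    have := stdCdf_symm (l * x)
    unfold snPdf
    rw [stdPhi_even, mul_neg]
    linear_combination (2 * stdPhi x) * this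
  rw [h3, integral_const_mul, stdPhi_integral] at h2
  linarith

lemma snCdf_hasDeriv (l x : ℝ) : HasDerivAt (snCdf l) (snPdf l x) x :=
  hasDeriv_Iic (snPdf_cont l) (snPdf_integrable l) x

lemma snCdf_tendsto (l : ℝ) : Tendsto (snCdf l) atTop (𝓝 1) := by
  have := tendsto_Iic (snPdf_integrable l)
  rwa [snPdf_integral] at this

lemma snCdf_strictMono (l : ℝ) : StrictMono (snCdf l) :=
  strictMono_of_hasDerivAt_pos (fun x => snCdf_hasDeriv l x) (fun x => snPdf_pos l x)

lemma snCdf_lt_one (l x : ℝ) : snCdf l x < 1 :=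
  ((snCdf_strictMono l) (lt_add_one x)).trans_le
    ((snCdf_strictMono l).monotone.ge_of_tendsto (snCdf_tendsto l) _)

lemma b_tendsto (l : ℝ) (b : ℕ → ℝ)
    (hb : ∀ n : ℕ, 2 ≤ n → snCdf l (b n) = 1 - 1 / n) : Tendsto b atTop atTop := by
  rw [tendsto_atTop]
  intro M
  have h : Tendsto (fun n : ℕ => 1 - 1 / (n : ℝ)) atTop (𝓝 (1 - 0)) :=
    tendsto_const_nhds.sub tendsto_one_div_atTop_nhds_zero_nat
  rw [sub_zero] at h
  filter_upwards [h.eventually (lt_mem_nhds (snCdf_lt_one l M)), eventually_ge_atTop 2] with n h1 h2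
  rw [← hb n h2] at h1
  exact ((snCdf_strictMono l).lt_iff_lt.1 h1).le

/-- polynomial times the normal density tends to zero -/
lemma pow_mul_phi (k : ℕ) {l : ℝ} (hl : 0 < l) :
    Tendsto (fun t => t ^ k * stdPhi (l * t)) atTop (𝓝 0) := by
  have h := (tendsto_rpow_abs_mul_exp_neg_mul_sq_cocompact (a := l^2/2) (by positivity) k).mono_left
    atTop_le_cocompact
  have h2 := h.const_mul (Real.sqrt (2 * Real.pi))⁻¹
  rw [mul_zero] at h2
  refine h2.congr' ?_
  filter_upwards [eventually_gt_atTop 0] with t ht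
  rw [abs_of_pos ht, Real.rpow_natCast]
  unfold stdPhi
  have : -(l * t)^2/2 = -(l^2/2) * t^2 := by ring
  rw [this]; ring

lemma pow_mul_Q {l : ℝ} (hl : 0 < l) :
    Tendsto (fun t => t ^ 4 * (1 - stdCdf (l * t))) atTop (𝓝 0) := by
  have key : Tendsto (fun t : ℝ => (1 - stdCdf (l * t)) / (t^4)⁻¹) atTop (𝓝 0) := by
    refine HasDerivAt.lhopital_zero_atTop (f' := fun t => -(l * stdPhi (l * t)))
      (g' := fun t => -(4 * t^3) / (t^4)^2) ?_ ?_ ?_ ?_ ?_ ?_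
    · refine Eventually.of_forall fun t => ?_
      have h := (stdCdf_hasDeriv (l * t)).comp t ((hasDerivAt_id t).const_mul l)
      have := h.const_sub 1
      convert! this using 1
      simp; ring
    · filter_upwards [eventually_gt_atTop 0] with t ht
      have := (hasDerivAt_pow 4 t).inv (by positivity)
      convert! this using 1
    · filter_upwards [eventually_gt_atTop 0] with t ht
      have : 0 < (4 * t^3) / (t^4)^2 := by positivity
      rw [neg_div]; linarith
    · have := (stdCdf_tendsto.comp (tendsto_id.const_mul_atTop hl)).const_sub 1
      simpa using this
    · exact (tendsto_pow_atTop (by norm_num)).inv_tendsto_atTop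
    · have := (pow_mul_phi 5 hl).const_mul (l/4)
      rw [mul_zero] at this
      refine this.congr' ?_
      filter_upwards [eventually_gt_atTop 0] with t ht
      field_simp
  refine key.congr fun t => ?_
  rw [div_inv_eq_mul]; ring

/-- normalized tail remainder -/
noncomputable def erem (l t : ℝ) : ℝ :=
  ((1 - snCdf l t) - 2 * stdPhi t * (t⁻¹ - (t^3)⁻¹)) / (2 * stdPhi t * (t^5)⁻¹)

lemma hasDeriv_inv_pow (k : ℕ) (t : ℝ) (ht : 0 < t) :
    HasDerivAt (fun t : ℝ => (t^k)⁻¹) (-(k * (t^(k+1))⁻¹)) t := by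
  have := (hasDerivAt_pow k t).inv (by positivity)
  convert! this using 1
  rcases k with _ | k
  · simp
  · simp; field_simp; ring

lemma erem_tendsto {l : ℝ} (hl : 0 < l) : Tendsto (erem l) atTop (𝓝 3) := by
  unfold erem
  have hphi : Tendsto stdPhi atTop (𝓝 0) := by simpa using pow_mul_phi 0 (l := 1) one_pos
  have hinv : ∀ k : ℕ, k ≠ 0 → Tendsto (fun t : ℝ => (t^k)⁻¹) atTop (𝓝 0) := fun k hk =>
    (tendsto_pow_atTop hk).inv_tendsto_atTop
  refine HasDerivAt.lhopital_zero_atTop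
    (f' := fun t => 2 * stdPhi t * ((1 - stdCdf (l * t)) - 3 * (t^4)⁻¹))
    (g' := fun t => 2 * stdPhi t * (-(t^4)⁻¹ - 5 * (t^6)⁻¹)) ?_ ?_ ?_ ?_ ?_ ?_
  · filter_upwards [eventually_gt_atTop 0] with t ht
    have h1 := (snCdf_hasDeriv l t).const_sub 1
    have h2 := hasDeriv_inv_pow 1 t ht
    have h3 := hasDeriv_inv_pow 3 t ht
    have h4 := h1.sub (((stdPhi_hasDeriv t).const_mul 2).mul (h2.sub h3))
    simp only [pow_one] at h4
    convert! h4 using 1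
    simp only [snPdf, Pi.sub_apply]
    push_cast
    field_simp
    ring
  · filter_upwards [eventually_gt_atTop 0] with t ht
    have h4 := (((stdPhi_hasDeriv t).const_mul 2).mul (hasDeriv_inv_pow 5 t ht))
    convert! h4 using 1
    push_cast
    field_simp
    ring
  · filter_upwards [eventually_gt_atTop 0] with t ht
    have := stdPhi_pos t
    have h : 0 < 2 * stdPhi t * ((t^4)⁻¹ + 5 * (t^6)⁻¹) := by positivity
    apply ne_of_lt
    nlinarith
  · have h1 := (snCdf_tendsto l).const_sub 1
    have h2 := h1.sub ((hphi.const_mul 2).mul ((hinv 1 one_ne_zero).sub (hinv 3 (by norm_num))))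
    simpa using h2
  · simpa using (hphi.const_mul 2).mul (hinv 5 (by norm_num))
  · have h := ((pow_mul_Q hl).sub_const 3).div (((hinv 2 (by norm_num)).const_mul (-5)).sub_const 1)
      (by norm_num)
    have : ((0:ℝ) - 3) / (-5 * 0 - 1) = 3 := by norm_num
    rw [this] at h
    refine h.congr' ?_
    filter_upwards [eventually_gt_atTop 0] with t ht
    have := stdPhi_pos t
    have h1 : (-5:ℝ) * (t^2)⁻¹ - 1 ≠ 0 := by
      have : 0 < (t^2)⁻¹ := by positivity
      linarith
    have h2 : -(t^4)⁻¹ - 5 * (t^6)⁻¹ ≠ 0 := by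
      have : 0 < (t^4)⁻¹ := by positivity
      have : 0 < (t^6)⁻¹ := by positivity
      linarith
    simp only [Pi.div_apply]
    rw [mul_div_mul_left _ _ (by positivity), div_eq_div_iff h1 h2]
    field_simp
    ring

lemma tail_eq (l : ℝ) {t : ℝ} (ht : 0 < t) :
    1 - snCdf l t = 2 * stdPhi t * t⁻¹ * (1 - (t⁻¹)^2 + erem l t * (t⁻¹)^4) := by
  have := stdPhi_pos t
  unfold erem
  field_simp
  ring

/-- second order expansion in the small parameter `u` -/
def Ex2 {α : Type} (L : Filter α) (u f : α → ℝ) (a b c : ℝ) : Prop :=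
  ∃ d : α → ℝ, Tendsto d L (𝓝 c) ∧ ∀ᶠ s in L, f s = a + b * u s + d s * u s ^ 2

lemma Ex2.tendsto {α : Type} {L : Filter α} {u f : α → ℝ} {a b c : ℝ} (hu : Tendsto u L (𝓝 0))
    (h : Ex2 L u f a b c) : Tendsto f L (𝓝 a) := by
  obtain ⟨d, hd, he⟩ := h
  have : Tendsto (fun s => a + b * u s + d s * u s ^ 2) L (𝓝 (a + b * 0 + c * 0 ^ 2)) :=
    (tendsto_const_nhds.add (hu.const_mul b)).add (hd.mul (hu.pow 2))
  simp only [mul_zero, add_zero, ne_eq, OfNat.ofNat_ne_zero, not_false_eq_true, zero_pow] at this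
  exact this.congr' (he.mono fun s hs => hs.symm)

lemma Ex2.mul {α : Type} {L : Filter α} {u f g : α → ℝ} {a b c a' b' c' : ℝ}
    (hu : Tendsto u L (𝓝 0))
    (h : Ex2 L u f a b c) (h' : Ex2 L u g a' b' c') :
    Ex2 L u (fun s => f s * g s) (a * a') (a * b' + b * a') (a * c' + b * b' + c * a') := by
  obtain ⟨d, hd, he⟩ := h
  obtain ⟨d', hd', he'⟩ := h'
  refine ⟨fun s => a * d' s + b * b' + d s * a' + (b * d' s + d s * b') * u s
    + d s * d' s * u s ^ 2, ?_, ?_⟩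
  · have := ((((hd'.const_mul a).add_const (b * b')).add (hd.mul_const a')).add
      (((hd'.const_mul b).add (hd.mul_const b')).mul hu)).add ((hd.mul hd').mul (hu.pow 2))
    simpa using this
  · filter_upwards [he, he'] with s h1 h2
    rw [h1, h2]; ring

lemma Ex2.const_mul {α : Type} {L : Filter α} {u f : α → ℝ} {a b c : ℝ} (k : ℝ)
    (h : Ex2 L u f a b c) :
    Ex2 L u (fun s => k * f s) (k * a) (k * b) (k * c) := by
  obtain ⟨d, hd, he⟩ := h
  refine ⟨fun s => k * d s, hd.const_mul k, ?_⟩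
  filter_upwards [he] with s h1
  rw [h1]; ring

lemma Ex2.inv {α : Type} {L : Filter α} {u f : α → ℝ} {b c : ℝ} (hu : Tendsto u L (𝓝 0))
    (h : Ex2 L u f 1 b c) : Ex2 L u (fun s => (f s)⁻¹) 1 (-b) (b ^ 2 - c) := by
  have hf := h.tendsto hu
  obtain ⟨d, hd, he⟩ := h
  refine ⟨fun s => (b ^ 2 - d s + b * d s * u s) / f s, ?_, ?_⟩
  · have := (((hd.const_sub (b ^ 2)).add ((hd.const_mul b).mul hu))).div hf one_ne_zero
    simp only [mul_zero, add_zero, div_one] at this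
    exact this
  · filter_upwards [he, hf.eventually_ne one_ne_zero] with s h1 h2
    field_simp
    rw [h1]; ring

lemma exp_second : ∃ h : ℝ → ℝ, Tendsto h (𝓝 0) (𝓝 (1 / 2)) ∧
    ∀ y, Real.exp y = 1 + y + y ^ 2 * h y := by
  refine ⟨fun y => if y = 0 then 1 / 2 else (Real.exp y - 1 - y) / y ^ 2, ?_, ?_⟩
  · rw [tendsto_iff_norm_sub_tendsto_zero]
    have h0 : Tendsto (fun y : ℝ => |y|) (𝓝 0) (𝓝 0) := by
      simpa using (continuous_abs.tendsto (0 : ℝ))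
    refine squeeze_zero' (Eventually.of_forall fun y => norm_nonneg _) ?_ h0
    have h1 : ∀ᶠ y : ℝ in 𝓝 0, |y| < 1 := h0.eventually (gt_mem_nhds one_pos)
    filter_upwards [h1] with y hy
    by_cases h : y = 0
    · simp [h]
    · simp only [h, if_false, Real.norm_eq_abs]
      have hb := Real.exp_bound hy.le (n := 3) (by norm_num)
      simp [Finset.sum_range_succ, Nat.factorial] at hb
      have e : (Real.exp y - 1 - y) / y ^ 2 - 1 / 2 = (Real.exp y - (1 + y + y ^ 2 / 2)) / y ^ 2 := by
        field_simp; ring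
      rw [e, abs_div, abs_of_nonneg (sq_nonneg y), div_le_iff₀ (by positivity)]
      refine hb.trans ?_
      have : |y| * y ^ 2 = |y| ^ 3 := by rw [← sq_abs]; ring
      rw [this]
      have : 0 ≤ |y| ^ 3 := by positivity
      norm_num
      linarith
  · intro y
    by_cases h : y = 0
    · simp [h]
    · simp only [h, if_false]
      field_simp; ring

lemma Ex2.exp {α : Type} {L : Filter α} {u f : α → ℝ} {b c : ℝ} (hu : Tendsto u L (𝓝 0))
    (h : Ex2 L u f 0 b c) :
    Ex2 L u (fun s => Real.exp (f s)) 1 b (c + b ^ 2 / 2) := by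
  have hf := h.tendsto hu
  obtain ⟨d, hd, he⟩ := h
  obtain ⟨k, hk, hk'⟩ := exp_second
  refine ⟨fun s => d s + (b + d s * u s) ^ 2 * k (f s), ?_, ?_⟩
  · have := hd.add ((((hd.mul hu).const_add b).pow 2).mul (hk.comp hf))
    have e : c + (b + c * 0) ^ 2 * (1 / 2) = c + b ^ 2 / 2 := by ring
    rw [e] at this
    exact this
  · filter_upwards [he] with s h1
    rw [hk' (f s)]
    generalize k (f s) = z
    rw [h1]; ring

lemma log_second {y : ℝ} (hy : |y| ≤ 1 / 2) : |Real.log (1 - y) + y| ≤ 2 * y ^ 2 := by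
  have := Real.abs_log_sub_add_sum_range_le (x := y) (by linarith) 1
  simp at this
  rw [add_comm]
  refine this.trans ?_
  rw [div_le_iff₀ (by linarith)]
  nlinarith [sq_nonneg y]

/-- normalized tail -/
noncomputable def gtail (l t : ℝ) : ℝ := 1 - (t⁻¹) ^ 2 + erem l t * (t⁻¹) ^ 4

lemma u_tendsto : Tendsto (fun s : ℝ => (s ^ 2)⁻¹) atTop (𝓝 0) :=
  (tendsto_pow_atTop (by norm_num)).inv_tendsto_atTop

lemma ex_lin (x : ℝ) : Ex2 atTop (fun s : ℝ => (s ^ 2)⁻¹) (fun s => 1 + x * (s ^ 2)⁻¹) 1 x 0 :=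
  ⟨fun _ => 0, tendsto_const_nhds, Eventually.of_forall fun s => by simp⟩

lemma t_tendsto (x : ℝ) : Tendsto (fun s : ℝ => s⁻¹ * x + s) atTop atTop := by
  have h : Tendsto (fun s : ℝ => s⁻¹ * x) atTop (𝓝 (0 * x)) := tendsto_inv_atTop_zero.mul_const x
  exact h.add_atTop tendsto_id

lemma t_inv (x : ℝ) {s : ℝ} (hs : 0 < s) :
    (s⁻¹ * x + s)⁻¹ = s⁻¹ * (1 + x * (s ^ 2)⁻¹)⁻¹ := by
  rw [← mul_inv]; congr 1; field_simp; ring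

lemma ex_gtail {l : ℝ} (hl : 0 < l) (x : ℝ) :
    Ex2 atTop (fun s : ℝ => (s ^ 2)⁻¹) (fun s => gtail l (s⁻¹ * x + s)) 1 (-1) (2 * x + 3) := by
  have hu := u_tendsto
  have hl1 := (ex_lin x).tendsto hu
  refine ⟨fun s => (2 * x + x ^ 2 * (s ^ 2)⁻¹) * ((1 + x * (s ^ 2)⁻¹)⁻¹) ^ 2
    + erem l (s⁻¹ * x + s) * ((1 + x * (s ^ 2)⁻¹)⁻¹) ^ 4, ?_, ?_⟩
  · have h1 := hl1.inv₀ one_ne_zero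
    have h2 := (erem_tendsto hl).comp (t_tendsto x)
    have h3 := (((hu.const_mul (x ^ 2)).const_add (2 * x)).mul (h1.pow 2)).add (h2.mul (h1.pow 4))
    simpa using h3
  · filter_upwards [eventually_gt_atTop 0, hl1.eventually_ne one_ne_zero] with s hs h1
    unfold gtail
    rw [t_inv x hs]
    generalize erem l (s⁻¹ * x + s) = z
    have e : s⁻¹ ^ 2 = (s ^ 2)⁻¹ := by simp
    have e4 : s⁻¹ ^ 4 = ((s ^ 2)⁻¹) ^ 2 := by rw [← e]; ring
    rw [mul_pow, mul_pow, e, e4]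
    have hv := inv_mul_cancel₀ h1
    generalize (s ^ 2)⁻¹ = u at *
    generalize (1 + x * u)⁻¹ = v at *
    linear_combination (-u) * (1 + v * (1 + x * u)) * hv

lemma ex_ratio {l : ℝ} (hl : 0 < l) (x : ℝ) :
    Ex2 atTop (fun s : ℝ => (s ^ 2)⁻¹)
      (fun s => (1 - snCdf l (s⁻¹ * x + s)) / (1 - snCdf l s))
      (Real.exp (-x)) (Real.exp (-x) * (-(x ^ 2 + 2 * x) / 2))
      (Real.exp (-x) * ((x ^ 4 + 4 * x ^ 3 + 8 * x ^ 2 + 16 * x) / 8)) := by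
  have hu := u_tendsto
  have h1 : Ex2 atTop (fun s : ℝ => (s ^ 2)⁻¹)
      (fun s => Real.exp (-(x ^ 2) / 2 * (s ^ 2)⁻¹)) 1 (-(x ^ 2) / 2) (0 + (-(x ^ 2) / 2) ^ 2 / 2) :=
    Ex2.exp hu ⟨fun _ => 0, tendsto_const_nhds, Eventually.of_forall fun s => by simp⟩
  have h2 := (ex_lin x).inv hu
  have h3 := ex_gtail hl x
  have h4 := (ex_gtail hl 0).inv hu
  have h5 := (((h1.mul hu h2).mul hu h3).mul hu h4).const_mul (Real.exp (-x))
  obtain ⟨d, hd, he⟩ := h5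
  refine ⟨d, ?_, ?_⟩
  · convert hd using 2; ring
  · filter_upwards [he, eventually_gt_atTop 0, (t_tendsto x).eventually_gt_atTop 0] with s h hs ht
    have e : (1 - snCdf l (s⁻¹ * x + s)) / (1 - snCdf l s) = Real.exp (-x) *
        (Real.exp (-(x ^ 2) / 2 * (s ^ 2)⁻¹) * (1 + x * (s ^ 2)⁻¹)⁻¹ * gtail l (s⁻¹ * x + s) *
          (gtail l (s⁻¹ * 0 + s))⁻¹) := by
      rw [tail_eq l ht, tail_eq l hs, ← gtail, ← gtail, t_inv x hs, mul_zero, zero_add]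
      have hp : stdPhi (s⁻¹ * x + s)
          = Real.exp (-x) * Real.exp (-(x ^ 2) / 2 * (s ^ 2)⁻¹) * stdPhi s := by
        unfold stdPhi
        rw [mul_left_comm, ← Real.exp_add, ← Real.exp_add]
        congr 2
        field_simp; ring
      rw [hp]
      have := stdPhi_pos s
      generalize gtail l (s⁻¹ * x + s) = z
      generalize gtail l s = w
      generalize (1 + x * (s ^ 2)⁻¹)⁻¹ = v
      by_cases hw : w = 0
      · simp [hw]
      · field_simp
    rw [e, h]
    ring

lemma pow_tail {l : ℝ} (hl : 0 < l) : Tendsto (fun s => s ^ 4 * (1 - snCdf l s)) atTop (𝓝 0) := by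
  have h1 := (ex_gtail hl 0).tendsto u_tendsto
  have h2 := ((pow_mul_phi 3 one_pos).const_mul 2).mul h1
  rw [mul_zero, zero_mul] at h2
  refine h2.congr' ?_
  filter_upwards [eventually_gt_atTop 0] with s hs
  rw [tail_eq l hs, ← gtail, mul_zero, zero_add, one_mul]
  field_simp

theorem skew_normal_expansion_pos (l : ℝ) (hl : 0 < l) (b : ℕ → ℝ)
    (hb : ∀ n : ℕ, 2 ≤ n → snCdf l (b n) = 1 - 1 / n) (x : ℝ) :
    Tendsto (fun n : ℕ =>
      (b n) ^ 2 * ((b n) ^ 2 * ((snCdf l ((b n)⁻¹ * x + b n)) ^ n - gumbel x) -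
        kappaPos x * gumbel x)) atTop
      (𝓝 ((omegaPos x + (kappaPos x) ^ 2 / 2) * gumbel x)) := by
  have hbt := b_tendsto l b hb
  have hu : Tendsto (fun n => ((b n) ^ 2)⁻¹) atTop (𝓝 0) := u_tendsto.comp hbt
  have hrt := ((ex_ratio hl x).tendsto u_tendsto).comp hbt
  obtain ⟨d, hd, he⟩ := ex_ratio hl x
  have hGt : Tendsto (fun n => 1 - snCdf l ((b n)⁻¹ * x + b n)) atTop (𝓝 0) := by
    have := ((snCdf_tendsto l).comp ((t_tendsto x).comp hbt)).const_sub 1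
    simpa using this
  set y : ℕ → ℝ := fun n => 1 - snCdf l ((b n)⁻¹ * x + b n) with hy
  -- the logarithmic correction
  have hlog : Tendsto (fun n : ℕ => (b n) ^ 4 * (n * (Real.log (1 - y n) + y n))) atTop (𝓝 0) := by
    have h1 := (((pow_tail hl).comp hbt).mul (hrt.pow 2)).const_mul 2
    rw [zero_mul, mul_zero] at h1
    refine squeeze_zero_norm' ?_ h1
    have h2 : ∀ᶠ n in atTop, |y n| < 1 / 2 := by
      have := hGt.abs
      rw [abs_zero] at this
      exact this.eventually (gt_mem_nhds (by norm_num))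
    filter_upwards [h2, eventually_ge_atTop 2] with n h2 hn
    have hn0 : (0 : ℝ) < n := by positivity
    have h3 := log_second h2.le
    have h4 : 1 - snCdf l (b n) = 1 / n := by rw [hb n hn]; ring
    simp only [Function.comp]
    rw [h4, Real.norm_eq_abs, abs_mul, abs_mul, abs_of_pos hn0, abs_of_nonneg (by positivity : 0 ≤ b n ^ 4)]
    calc b n ^ 4 * (n * |Real.log (1 - y n) + y n|) ≤ b n ^ 4 * (n * (2 * y n ^ 2)) := by gcongr
      _ = 2 * (b n ^ 4 * (1 / n) * (y n / (1 / n)) ^ 2) := by field_simp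
  set D : ℕ → ℝ := fun n => -d (b n) + (b n) ^ 4 * (n * (Real.log (1 - y n) + y n)) with hD
  have hEx : Ex2 atTop (fun n => ((b n) ^ 2)⁻¹)
      (fun n : ℕ => n * Real.log (1 - y n) + Real.exp (-x)) 0 (kappaPos x) (omegaPos x) := by
    refine ⟨D, ?_, ?_⟩
    · have := (hd.comp hbt).neg.add hlog
      convert! this using 2
      unfold omegaPos; ring
    · filter_upwards [hbt.eventually he, hbt.eventually_gt_atTop 0, eventually_ge_atTop 2]
        with n h1 h2 hn
      have hn0 : (0 : ℝ) < n := by positivity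
      have h4 : 1 - snCdf l (b n) = 1 / n := by rw [hb n hn]; ring
      rw [h4] at h1
      have h5 : n * y n = y n / (1 / n) := by field_simp
      have h6 := h5.trans h1
      have e : (b n) ^ 4 * (((b n) ^ 2)⁻¹) ^ 2 = 1 := by field_simp
      simp only [hD, kappaPos]
      linear_combination (-1) * h6 - (n * (Real.log (1 - y n) + y n)) * e
  obtain ⟨d', hd', he'⟩ := hEx.exp hu
  refine ((hd'.mul_const (gumbel x))).congr' ?_
  have h2 : ∀ᶠ n in atTop, y n < 1 := hGt.eventually (gt_mem_nhds one_pos)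
  filter_upwards [he', h2, hbt.eventually_gt_atTop 0] with n h1 h2 h3
  have e1 : snCdf l ((b n)⁻¹ * x + b n) = 1 - y n := by simp [hy]
  have e2 : (1 - y n) ^ n = Real.exp (n * Real.log (1 - y n) + Real.exp (-x)) * gumbel x := by
    unfold gumbel
    rw [← Real.exp_add, add_neg_cancel_right, Real.exp_nat_mul, Real.exp_log (by linarith)]
  rw [e1, e2, h1]
  field_simp
  ring
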